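/- Let d ≥ 1, N ∈ ℕ, κ ∈ ℝ^{d+1} with each κ_i > −1, and let α ∈ ℕ^{d+1} with 1 ≤ |α| ≤ N. Then the explicitly defined monic Hahn polynomial Q_α(·; κ, N) is orthogonal to all polynomials of lower degree with respect to the Hahn weight: for every β ∈ ℕ^{d+1} with |β| < |α|, Σ_{x ∈ Z_N^{d+1}} Q_α(x; κ, N) · m_β(x) · (κ+1)_x / x! = 0. Moreover Q_α(·; κ, N) is monic, i.e., in its defining expansion Σ_{γ ≤ α} c_γ m_γ the coefficient of m_α equals 1. -/

import Mathlib

open Finset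

/-- Pochhammer symbol `(a)_k = a (a+1) ⋯ (a+k-1)`. -/
noncomputable def poch (a : ℝ) : ℕ → ℝ
  | 0 => 1
  | k + 1 => poch a k * (a + k)

/-- Multi-index Pochhammer `(x)_γ = ∏ i (x i)_{γ i}`. -/
noncomputable def pochV {m : ℕ} (x : Fin m → ℝ) (γ : Fin m → ℕ) : ℝ :=
  ∏ i, poch (x i) (γ i)

/-- Multi-index factorial `γ! = ∏ i (γ i)!` (as a real number). -/
noncomputable def mfact {m : ℕ} (γ : Fin m → ℕ) : ℝ :=
  ∏ i, (Nat.factorial (γ i) : ℝ)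

/-- Shifted monomial `m_γ(x) = (-1)^{|γ|} (-x)_γ`. -/
noncomputable def mono {m : ℕ} (γ : Fin m → ℕ) (x : Fin m → ℝ) : ℝ :=
  (-1 : ℝ) ^ (∑ i, γ i) * pochV (fun i => -(x i)) γ

/-- `Z_N^{d+1} = {α ∈ ℕ^{d+1} : |α| = N}` as a finite set. -/
def ZN (d N : ℕ) : Finset (Fin (d + 1) → ℕ) :=
  (Fintype.piFinset fun _ => Finset.range (N + 1)).filter fun α => ∑ i, α i = N

/-- `{ν ∈ ℕ^d : |ν| = n}` as a finite set. -/
def idxSet (d n : ℕ) : Finset (Fin d → ℕ) :=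
  (Fintype.piFinset fun _ => Finset.range (n + 1)).filter fun ν => ∑ i, ν i = n

/-- The finite set `{γ ∈ ℕ^m : γ ≤ α}`. -/
def below {m : ℕ} (α : Fin m → ℕ) : Finset (Fin m → ℕ) :=
  Fintype.piFinset fun i => Finset.range (α i + 1)

/-- Monic Hahn polynomial `Q_α(x; κ, N)`. -/
noncomputable def monicQ (d N : ℕ) (κ : Fin (d + 1) → ℝ) (α : Fin (d + 1) → ℕ)
    (x : Fin (d + 1) → ℝ) : ℝ :=
  poch (-(N : ℝ)) (∑ i, α i) * pochV (fun i => κ i + 1) α /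
      poch ((∑ i, κ i) + d + (∑ i, α i)) (∑ i, α i) *
    ∑ γ ∈ below α,
      pochV (fun i => -(α i : ℝ)) γ * poch ((∑ i, κ i) + d + (∑ i, α i)) (∑ i, γ i) *
          (-1 : ℝ) ^ (∑ i, γ i) /
          (mfact γ * pochV (fun i => κ i + 1) γ * poch (-(N : ℝ)) (∑ i, γ i)) *
        mono γ x

/-- One-variable Hahn polynomial `Q_n(x; a, b, M)` (a `₃F₂` sum). -/
noncomputable def hahn1 (n : ℕ) (x a b M : ℝ) : ℝ :=
  ∑ k ∈ Finset.range (n + 1),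
    poch (-(n : ℝ)) k * poch ((n : ℝ) + a + b + 1) k * poch (-x) k /
      (poch (a + 1) k * poch (-M) k * (Nat.factorial k : ℝ))

/-- The parameter `a_j = κ_{j+1}+⋯+κ_{d+1} + 2|ν^{j+1}| + d - j` (1-based `j`). -/
noncomputable def aj (d : ℕ) (κ : Fin (d + 1) → ℝ) (ν : Fin d → ℕ) (j : Fin d) : ℝ :=
  (∑ i ∈ Finset.univ.filter (fun i : Fin (d + 1) => (j : ℕ) < (i : ℕ)), κ i) +
    2 * (∑ i ∈ Finset.univ.filter (fun i : Fin d => (j : ℕ) < (i : ℕ)), (ν i : ℝ)) +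
    ((d - 1 - (j : ℕ) : ℕ) : ℝ)

/-- `|x_{j-1}| = x_1 + ⋯ + x_{j-1}` (1-based `j`). -/
noncomputable def sumLt (d : ℕ) (x : Fin (d + 1) → ℕ) (j : Fin d) : ℝ :=
  ∑ i ∈ Finset.univ.filter (fun i : Fin (d + 1) => (i : ℕ) < (j : ℕ)), (x i : ℝ)

/-- `|ν^{j+1}| = ν_{j+1} + ⋯ + ν_d` (1-based `j`). -/
noncomputable def sumGt (d : ℕ) (ν : Fin d → ℕ) (j : Fin d) : ℝ :=
  ∑ i ∈ Finset.univ.filter (fun i : Fin d => (j : ℕ) < (i : ℕ)), (ν i : ℝ)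

/-- Hahn polynomial of `d` variables `H_ν(x; κ, N)`. -/
noncomputable def hahnH (d N : ℕ) (κ : Fin (d + 1) → ℝ) (ν : Fin d → ℕ)
    (x : Fin (d + 1) → ℕ) : ℝ :=
  (-1 : ℝ) ^ (∑ i, ν i) / poch (-(N : ℝ)) (∑ i, ν i) *
    ∏ j : Fin d,
      poch (κ j.castSucc + 1) (ν j) / poch (aj d κ ν j + 1) (ν j) *
        poch (-(N : ℝ) + sumLt d x j + sumGt d ν j) (ν j) *
        hahn1 (ν j) (x j.castSucc : ℝ) (κ j.castSucc) (aj d κ ν j)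
          ((N : ℝ) - sumLt d x j - sumGt d ν j)

/-- Squared norm `B_ν(κ, N)` of the Hahn polynomial `H_ν(·; κ, N)`. -/
noncomputable def Bnorm (d N : ℕ) (κ : Fin (d + 1) → ℝ) (ν : Fin d → ℕ) : ℝ :=
  (-1 : ℝ) ^ (∑ i, ν i) * poch ((∑ i, κ i) + d + 1) (N + ∑ i, ν i) /
      (poch (-(N : ℝ)) (∑ i, ν i) * poch ((∑ i, κ i) + d + 1) N *
        poch ((∑ i, κ i) + d + 1) (2 * ∑ i, ν i)) *
    ∏ j : Fin d,
      poch (κ j.castSucc + aj d κ ν j + 1) (2 * ν j) * poch (κ j.castSucc + 1) (ν j) *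
          (Nat.factorial (ν j) : ℝ) /
        (poch (κ j.castSucc + aj d κ ν j + 1) (ν j) * poch (aj d κ ν j + 1) (ν j))

/-- Projection `Q_{α,n}(x; κ, N)` of `m_α/(κ+1)_α` onto the space of degree `n`. -/
noncomputable def monicQn (d N : ℕ) (κ : Fin (d + 1) → ℝ) (α : Fin (d + 1) → ℕ) (n : ℕ)
    (x : Fin (d + 1) → ℝ) : ℝ :=
  (-1 : ℝ) ^ (∑ i, α i) * poch (-(N : ℝ)) (∑ i, α i) * poch ((∑ i, κ i) + d + 1) (2 * n) /
      (poch (-(N : ℝ)) n * poch ((∑ i, κ i) + d + 1) ((∑ i, α i) + n)) *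
    ∑ β ∈ ZN d n,
      pochV (fun i => -(α i : ℝ)) β / (mfact β * pochV (fun i => κ i + 1) β) *
        monicQ d N κ β x

/-- The kernel `E_k(x, y; κ) = Σ_{|γ|=k} (-x)_γ (-y)_γ / (γ! (κ+1)_γ)`. -/
noncomputable def Efun (d : ℕ) (κ : Fin (d + 1) → ℝ) (x y : Fin (d + 1) → ℕ) (k : ℕ) : ℝ :=
  ∑ γ ∈ ZN d k,
    pochV (fun i => -(x i : ℝ)) γ * pochV (fun i => -(y i : ℝ)) γ /
      (mfact γ * pochV (fun i => κ i + 1) γ)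

/-- Monic Jacobi polynomial on the simplex `R_α^κ(x)`. -/
noncomputable def jacobiR (d : ℕ) (κ : Fin (d + 1) → ℝ) (α : Fin (d + 1) → ℕ)
    (x : Fin d → ℝ) : ℝ :=
  (-1 : ℝ) ^ (∑ i, α i) * pochV (fun i => κ i + 1) α /
      poch ((∑ i, κ i) + d + (∑ i, α i)) (∑ i, α i) *
    ∑ γ ∈ below α,
      pochV (fun i => -(α i : ℝ)) γ * poch ((∑ i, κ i) + d + (∑ i, α i)) (∑ i, γ i) /
          (pochV (fun i => κ i + 1) γ * mfact γ) *
        ∏ i, (Fin.snoc x (1 - ∑ i, x i) : Fin (d + 1) → ℝ) i ^ γ i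

/-- One-variable Krawtchouk polynomial `K_n(x; p, M)`. -/
noncomputable def kraw1 (n : ℕ) (x p M : ℝ) : ℝ :=
  ∑ k ∈ Finset.range (n + 1),
    poch (-(n : ℝ)) k * poch (-x) k / (poch (-M) k * (Nat.factorial k : ℝ) * p ^ k)

/-- The extended parameter `𝛒 = (ρ_1, …, ρ_d, 1 - |ρ|)`. -/
noncomputable def brho (d : ℕ) (ρ : Fin d → ℝ) : Fin (d + 1) → ℝ :=
  Fin.snoc ρ (1 - ∑ i, ρ i)

/-- `𝛒^γ = ∏ i 𝛒_i^{γ i}`. -/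
noncomputable def bpow (d : ℕ) (ρ : Fin d → ℝ) (γ : Fin (d + 1) → ℕ) : ℝ :=
  ∏ i, brho d ρ i ^ γ i

/-- `|𝛒_j| = ρ_1 + ⋯ + ρ_j` (1-based `j`). -/
noncomputable def sumLe (d : ℕ) (ρ : Fin d → ℝ) (j : Fin d) : ℝ :=
  ∑ i ∈ Finset.univ.filter (fun i : Fin d => (i : ℕ) ≤ (j : ℕ)), ρ i

/-- `|𝛒_{j-1}| = ρ_1 + ⋯ + ρ_{j-1}` (1-based `j`). -/
noncomputable def sumLtρ (d : ℕ) (ρ : Fin d → ℝ) (j : Fin d) : ℝ :=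
  ∑ i ∈ Finset.univ.filter (fun i : Fin d => (i : ℕ) < (j : ℕ)), ρ i

/-- Krawtchouk polynomial of `d` variables `K_ν(x; ρ, N)`. -/
noncomputable def krawH (d N : ℕ) (ρ : Fin d → ℝ) (ν : Fin d → ℕ)
    (x : Fin (d + 1) → ℕ) : ℝ :=
  (-1 : ℝ) ^ (∑ i, ν i) / poch (-(N : ℝ)) (∑ i, ν i) *
    ∏ j : Fin d,
      ρ j ^ ν j / (1 - sumLe d ρ j) ^ ν j *
        poch (-(N : ℝ) + sumLt d x j + sumGt d ν j) (ν j) *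
        kraw1 (ν j) (x j.castSucc : ℝ) (ρ j / (1 - sumLtρ d ρ j))
          ((N : ℝ) - sumLt d x j - sumGt d ν j)

/-- Squared norm `C_ν(ρ, N)` of the Krawtchouk polynomial `K_ν(·; ρ, N)`. -/
noncomputable def Cnorm (d N : ℕ) (ρ : Fin d → ℝ) (ν : Fin d → ℕ) : ℝ :=
  (-1 : ℝ) ^ (∑ i, ν i) / (poch (-(N : ℝ)) (∑ i, ν i) * (Nat.factorial N : ℝ)) *
    ∏ j : Fin d,
      (Nat.factorial (ν j) : ℝ) * ρ j ^ ν j /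
        (1 - sumLe d ρ j) ^ ((ν j : ℤ) - ((Fin.snoc ν 0 : Fin (d + 1) → ℕ) j.succ : ℤ))

/-- Monic Krawtchouk polynomial `L_α(x; ρ, N)`. -/
noncomputable def monicL (d N : ℕ) (ρ : Fin d → ℝ) (α : Fin (d + 1) → ℕ)
    (x : Fin (d + 1) → ℝ) : ℝ :=
  poch (-(N : ℝ)) (∑ i, α i) * bpow d ρ α *
    ∑ γ ∈ below α,
      pochV (fun i => -(α i : ℝ)) γ * (-1 : ℝ) ^ (∑ i, γ i) /
          (mfact γ * poch (-(N : ℝ)) (∑ i, γ i) * bpow d ρ γ) *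
        mono γ x

/-- Projection `L_{α,n}(x; ρ, N)` of `m_α/𝛒^α` onto the space of degree `n`. -/
noncomputable def monicLn (d N : ℕ) (ρ : Fin d → ℝ) (α : Fin (d + 1) → ℕ) (n : ℕ)
    (x : Fin (d + 1) → ℝ) : ℝ :=
  (-1 : ℝ) ^ (∑ i, α i) * poch (-(N : ℝ)) (∑ i, α i) / poch (-(N : ℝ)) n *
    ∑ β ∈ ZN d n,
      pochV (fun i => -(α i : ℝ)) β / (mfact β * bpow d ρ β) * monicL d N ρ β x

/-- The kernel `F_k(x, y; ρ) = Σ_{|γ|=k} (-x)_γ (-y)_γ / (γ! 𝛒^γ)`. -/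
noncomputable def Ffun (d : ℕ) (ρ : Fin d → ℝ) (x y : Fin (d + 1) → ℕ) (k : ℕ) : ℝ :=
  ∑ γ ∈ ZN d k,
    pochV (fun i => -(x i : ℝ)) γ * pochV (fun i => -(y i : ℝ)) γ / (mfact γ * bpow d ρ γ)


theorem poch_add (a : ℝ) (m n : ℕ) : poch a (m + n) = poch a m * poch (a + m) n := by
  induction n with
  | zero => simp [poch]
  | succ n ih =>
    rw [← add_assoc, poch, poch, ih]
    push_cast
    ring

theorem poch_mul_poch_comm (a : ℝ) (m n : ℕ) :
    poch a m * poch (a + m) n = poch a n * poch (a + n) m := by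
  rw [← poch_add, ← poch_add, add_comm]

theorem poch_pos {a : ℝ} (ha : 0 < a) (k : ℕ) : 0 < poch a k := by
  induction k with
  | zero => simp [poch]
  | succ k ih => exact mul_pos ih (by positivity)

theorem poch_neg_natCast_mul_factorial {N k : ℕ} (hk : k ≤ N) :
    poch (-(N : ℝ)) k * (Nat.factorial (N - k) : ℝ) = (-1) ^ k * (Nat.factorial N : ℝ) := by
  induction k with
  | zero => simp [poch]
  | succ k ih =>
    have h : N - k = (N - (k + 1)) + 1 := by omega
    have hc : ((N - (k + 1) : ℕ) : ℝ) = N - (k + 1) := by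
      rw [Nat.cast_sub hk]; push_cast; ring
    have := ih (by omega)
    rw [h, Nat.factorial_succ] at this
    push_cast at this
    rw [hc] at this
    rw [poch, pow_succ]
    linear_combination -this

theorem poch_neg_natCast_ne_zero {N k : ℕ} (hk : k ≤ N) : poch (-(N : ℝ)) k ≠ 0 := by
  intro h
  have := poch_neg_natCast_mul_factorial hk
  rw [h, zero_mul] at this
  exact (mul_ne_zero (pow_ne_zero _ (by norm_num)) (by positivity)) this.symm

theorem poch_neg_natCast_eq_zero {N k : ℕ} (hk : N < k) : poch (-(N : ℝ)) k = 0 := by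
  obtain ⟨j, rfl⟩ := Nat.exists_eq_add_of_lt hk
  rw [show N + j + 1 = (N + 1) + j by ring, poch_add, poch]
  simp

theorem poch_eq_eval_ascPochhammer (a : ℝ) (k : ℕ) : poch a k = (ascPochhammer ℝ k).eval a := by
  induction k with
  | zero => simp [poch]
  | succ k ih => rw [poch, ascPochhammer_succ_eval, ih]

theorem poch_neg_natCast_div_factorial {n k : ℕ} (hk : k ≤ n) :
    poch (-(n : ℝ)) k / (Nat.factorial k : ℝ) = (-1) ^ k * (n.choose k : ℝ) := by
  have h := poch_neg_natCast_mul_factorial hk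
  have h2 : ((n.choose k * k.factorial * (n - k).factorial : ℕ) : ℝ) = (n.factorial : ℕ) := by
    rw [Nat.choose_mul_factorial_mul_factorial hk]
  push_cast at h2
  rw [div_eq_iff (by positivity)]
  have h3 : ((n - k).factorial : ℝ) ≠ 0 := by positivity
  apply mul_right_cancel₀ h3
  rw [h, ← h2]
  ring

theorem sum_poch_neg_div_factorial_mul_poch {n b : ℕ} (a : ℝ) (hb : b < n) :
    ∑ k ∈ range (n + 1), poch (-(n : ℝ)) k / (Nat.factorial k : ℝ) * poch (a + k) b = 0 := by
  have hdeg : ((ascPochhammer ℝ b).comp (Polynomial.X + Polynomial.C a)).natDegree < n := by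
    rw [Polynomial.natDegree_comp, ascPochhammer_natDegree, Polynomial.natDegree_X_add_C]
    omega
  have h := congrFun (Polynomial.fwdDiff_iter_eq_zero_of_degree_lt hdeg) 0
  rw [fwdDiff_iter_eq_sum_shift] at h
  have h' := congrArg (fun t => (-1 : ℝ) ^ n * t) h
  simp only [Pi.zero_apply, mul_zero, Finset.mul_sum] at h'
  rw [← h']
  refine Finset.sum_congr rfl fun k hk => ?_
  have hk' : k ≤ n := by simpa [Nat.lt_succ_iff] using hk
  rw [poch_neg_natCast_div_factorial hk', poch_eq_eval_ascPochhammer]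
  have hs : (-1 : ℝ) ^ n * (-1) ^ (n - k) = (-1) ^ k := by
    rw [← pow_add, show n + (n - k) = 2 * (n - k) + k by omega, pow_add, pow_mul]
    simp
  simp only [Polynomial.eval_comp, Polynomial.eval_add, Polynomial.eval_X, Polynomial.eval_C,
    zsmul_eq_mul, nsmul_eq_mul, mul_one, zero_add]
  push_cast
  rw [← hs, add_comm a]
  ring

theorem pochV_add {m : ℕ} (x : Fin m → ℝ) (β γ : Fin m → ℕ) :
    pochV x (β + γ) = pochV x β * pochV (fun i => x i + β i) γ := by
  simp only [pochV, Pi.add_apply, poch_add, prod_mul_distrib]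

theorem pochV_single {m : ℕ} (x : Fin m → ℝ) (i : Fin m) : pochV x (Pi.single i 1) = x i := by
  rw [pochV, Finset.prod_eq_single i]
  · simp [poch]
  · intro j _ hj
    simp [hj, poch]
  · simp

theorem pochV_add_single {m : ℕ} (x : Fin m → ℝ) (β : Fin m → ℕ) (i : Fin m) :
    pochV x (β + Pi.single i 1) = pochV x β * (x i + β i) := by
  rw [pochV_add, pochV_single]

theorem pochV_pos {m : ℕ} {x : Fin m → ℝ} (hx : ∀ i, 0 < x i) (γ : Fin m → ℕ) :
    0 < pochV x γ :=
  Finset.prod_pos fun i _ => poch_pos (hx i) _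

theorem mfact_pos {m : ℕ} (γ : Fin m → ℕ) : 0 < mfact γ :=
  Finset.prod_pos fun i _ => by positivity

theorem sum_add_single {m : ℕ} (β : Fin m → ℕ) (i : Fin m) :
    ∑ j, (β + Pi.single i 1 : Fin m → ℕ) j = ∑ j, β j + 1 := by
  simp [Finset.sum_add_distrib]

theorem mono_add_single {m : ℕ} (β : Fin m → ℕ) (i : Fin m) (x : Fin m → ℝ) :
    mono (β + Pi.single i 1) x = mono β x * (x i - β i) := by
  rw [mono, mono, sum_add_single, pochV_add_single, pow_succ]
  ring

theorem mono_eq_prod {m : ℕ} (γ : Fin m → ℕ) (x : Fin m → ℝ) :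
    mono γ x = ∏ i, (-1 : ℝ) ^ γ i * poch (-(x i)) (γ i) := by
  rw [mono, pochV, prod_mul_distrib, Finset.prod_pow_eq_pow_sum]

theorem mono_natCast_add_mul_mfact {m : ℕ} (γ y : Fin m → ℕ) :
    mono γ (fun i => ((y + γ) i : ℝ)) * mfact y = mfact (y + γ) := by
  rw [mono_eq_prod, mfact, mfact, ← prod_mul_distrib]
  refine Finset.prod_congr rfl fun i _ => ?_
  have h := poch_neg_natCast_mul_factorial (N := y i + γ i) (k := γ i) (by omega)
  rw [Nat.add_sub_cancel] at h
  rw [Pi.add_apply, mul_assoc, h, ← mul_assoc, ← mul_pow]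
  simp

theorem mono_natCast_eq_zero {m : ℕ} {γ x : Fin m → ℕ} (h : ¬ γ ≤ x) :
    mono γ (fun i => (x i : ℝ)) = 0 := by
  obtain ⟨i, hi⟩ : ∃ i, x i < γ i := by simpa [Pi.le_def] using h
  rw [mono_eq_prod]
  exact Finset.prod_eq_zero (mem_univ i) (by rw [poch_neg_natCast_eq_zero hi, mul_zero])

theorem mem_ZN {d N : ℕ} {x : Fin (d + 1) → ℕ} : x ∈ ZN d N ↔ ∑ i, x i = N := by
  simp only [ZN, mem_filter, Fintype.mem_piFinset, mem_range, and_iff_right_iff_imp]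
  rintro rfl i
  exact Nat.lt_succ_of_le (Finset.single_le_sum (fun _ _ => Nat.zero_le _) (mem_univ i))

/-- Shifting the summation variable absorbs a falling factorial into the weight. -/
theorem sum_ZN_mono_mul_eq {d N : ℕ} (b : Fin (d + 1) → ℝ) (γ : Fin (d + 1) → ℕ)
    (hγ : ∑ i, γ i ≤ N) :
    ∑ x ∈ ZN d N, mono γ (fun i => (x i : ℝ)) * (pochV b x / mfact x) =
      pochV b γ * ∑ y ∈ ZN d (N - ∑ i, γ i), pochV (fun i => b i + γ i) y / mfact y := by
  have himage : (ZN d (N - ∑ i, γ i)).image (· + γ) ⊆ ZN d N := by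
    intro x hx
    obtain ⟨y, hy, rfl⟩ := mem_image.1 hx
    rw [mem_ZN] at hy ⊢
    simp only [Pi.add_apply, Finset.sum_add_distrib, hy]
    omega
  rw [← Finset.sum_subset himage, Finset.sum_image (fun _ _ _ _ h => add_right_cancel h),
    Finset.mul_sum]
  · refine Finset.sum_congr rfl fun y _ => ?_
    have h := mono_natCast_add_mul_mfact γ y
    have h1 := (mfact_pos y).ne'
    have h2 := (mfact_pos (y + γ)).ne'
    rw [← mul_div_assoc, ← mul_div_assoc, div_eq_div_iff h2 h1, mul_right_comm, h, add_comm y γ,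
      pochV_add]
    ring
  · intro x hx hx'
    rw [mono_natCast_eq_zero, zero_mul]
    intro hle
    refine hx' (mem_image.2 ⟨x - γ, ?_, tsub_add_cancel_of_le hle⟩)
    rw [mem_ZN] at hx ⊢
    rw [← hx, ← Finset.sum_tsub_distrib _ fun i _ => hle i]
    rfl

/-- The multivariate Chu–Vandermonde identity. -/
theorem sum_ZN_pochV_div_mfact {d : ℕ} (M : ℕ) (b : Fin (d + 1) → ℝ) :
    ∑ y ∈ ZN d M, pochV b y / mfact y = poch (∑ i, b i) M / (Nat.factorial M : ℝ) := by
  induction M generalizing b with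
  | zero =>
    have h : ZN d 0 = {0} := by
      ext x
      simp [mem_ZN, funext_iff]
    simp [h, pochV, mfact, poch]
  | succ M ih =>
    have hx : ∀ i, ∑ x ∈ ZN d (M + 1), (x i : ℝ) * (pochV b x / mfact x) =
        b i * (poch (∑ i, b i + 1) M / (Nat.factorial M : ℝ)) := by
      intro i
      have h := sum_ZN_mono_mul_eq (N := M + 1) b (Pi.single i 1) (by simp)
      have hs : ∑ j, (b j + ((Pi.single i 1 : Fin (d + 1) → ℕ) j : ℝ)) = ∑ j, b j + 1 := by
        rw [Finset.sum_add_distrib, ← Nat.cast_sum]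
        simp
      rw [show M + 1 - ∑ j, (Pi.single i 1 : Fin (d + 1) → ℕ) j = M by simp, ih, hs,
        pochV_single] at h
      rw [← h]
      simp [mono, pochV_single]
    have hsum : ((M + 1 : ℕ) : ℝ) * ∑ x ∈ ZN d (M + 1), pochV b x / mfact x =
        (∑ i, b i) * (poch (∑ i, b i + 1) M / (Nat.factorial M : ℝ)) := by
      rw [Finset.sum_mul, ← Finset.sum_congr rfl fun i _ => hx i, Finset.sum_comm, Finset.mul_sum]
      refine Finset.sum_congr rfl fun x hx => ?_
      rw [← Finset.sum_mul, ← mem_ZN.1 hx]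
      push_cast
      rfl
    have hp : poch (∑ i, b i) (M + 1) = (∑ i, b i) * poch (∑ i, b i + 1) M := by
      rw [add_comm M, poch_add]
      simp [poch]
    rw [hp, Nat.factorial_succ]
    push_cast at hsum ⊢
    have h1 : (M : ℝ) + 1 ≠ 0 := by positivity
    have h2 : (M.factorial : ℝ) ≠ 0 := by positivity
    field_simp at hsum ⊢
    linear_combination hsum

/-- Alternating binomial sums over a box annihilate polynomials of degree less than `|α|`. -/
theorem sum_below_pochV_neg_mul_eq_zero {m : ℕ} (α β : Fin m → ℕ) (a : Fin m → ℝ) (c : ℝ) (k : ℕ)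
    (h : ∑ i, β i + k < ∑ i, α i) :
    ∑ γ ∈ below α, pochV (fun i => -(α i : ℝ)) γ / mfact γ *
      (pochV (fun i => a i + γ i) β * poch (c + (∑ i, γ i : ℕ)) k) = 0 := by
  induction k generalizing β with
  | zero =>
    obtain ⟨i, -, hi⟩ := Finset.exists_lt_of_sum_lt (show ∑ i, β i < ∑ i, α i from h)
    simp only [pochV, mfact, poch, mul_one, ← prod_div_distrib, ← prod_mul_distrib, below]
    rw [← Finset.prod_univ_sum (fun i => range (α i + 1)) fun i k =>
      poch (-(α i : ℝ)) k / (Nat.factorial k : ℝ) * poch (a i + k) (β i)]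
    exact Finset.prod_eq_zero (mem_univ i) (sum_poch_neg_div_factorial_mul_poch _ hi)
  | succ k ih =>
    set T : (Fin m → ℕ) → ℝ := fun β => ∑ γ ∈ below α, pochV (fun i => -(α i : ℝ)) γ / mfact γ *
      (pochV (fun i => a i + γ i) β * poch (c + (∑ i, γ i : ℕ)) k) with hT
    have h0 : T β = 0 := ih β (by omega)
    have h1 : ∀ i, T (β + Pi.single i 1) = 0 := fun i => ih _ (by rw [sum_add_single]; omega)
    have hcomb : ∑ γ ∈ below α, pochV (fun i => -(α i : ℝ)) γ / mfact γ *
        (pochV (fun i => a i + γ i) β * poch (c + (∑ i, γ i : ℕ)) (k + 1)) =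
        ∑ i, T (β + Pi.single i 1) + (c + k - ∑ i, (a i + β i)) * T β := by
      simp only [hT]
      rw [Finset.sum_comm, Finset.mul_sum, ← Finset.sum_add_distrib]
      refine Finset.sum_congr rfl fun γ _ => ?_
      simp only [pochV_add_single, poch]
      rw [← Finset.mul_sum, ← Finset.sum_mul, ← Finset.mul_sum]
      push_cast
      simp only [Finset.sum_add_distrib]
      ring
    rw [hcomb, h0]
    simp [h1]

theorem sum_le_of_mem_below {m : ℕ} {α γ : Fin m → ℕ} (h : γ ∈ below α) :
    ∑ i, γ i ≤ ∑ i, α i :=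
  Finset.sum_le_sum fun i _ => Nat.lt_succ_iff.1 (mem_range.1 (Fintype.mem_piFinset.1 h i))

theorem sum_ZN_monicQ_mul_pochV {d N : ℕ} {κ : Fin (d + 1) → ℝ} (hκ : ∀ i, -1 < κ i)
    {α β : Fin (d + 1) → ℕ} (hN : ∑ i, α i ≤ N) (hβ : ∑ i, β i < ∑ i, α i) :
    ∑ x ∈ ZN d N, monicQ d N κ α (fun i => (x i : ℝ)) * pochV (fun i => κ i + 1 + x i) β *
      (pochV (fun i => κ i + 1) x / mfact x) = 0 := by
  have hκ' : ∀ i, 0 < κ i + 1 := fun i => by linarith [hκ i]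
  set n := ∑ i, α i
  set m := n - 1 - ∑ i, β i with hm
  set s : ℝ := ∑ i, (κ i + 1 + β i) with hs
  have hs0 : 0 < s := Finset.sum_pos (fun i _ => by have := hκ' i; positivity) univ_nonempty
  have hsm : (∑ i, κ i) + d + n = s + m := by
    have : (n : ℝ) = m + 1 + (∑ i, β i : ℕ) := by
      norm_cast
      omega
    rw [this, hs]
    simp only [Finset.sum_add_distrib]
    push_cast
    simp
    ring
  have hvanish := sum_below_pochV_neg_mul_eq_zero α β (fun i => κ i + 1) s m (by omega)
  have hpochV : ∀ γ : Fin (d + 1) → ℕ, pochV (fun i => κ i + 1) γ * pochV (fun i => κ i + 1 + γ i) β =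
      pochV (fun i => κ i + 1) β * pochV (fun i => κ i + 1 + β i) γ := fun γ => by
    rw [← pochV_add, ← pochV_add, add_comm γ]
  have hinner : ∀ γ ∈ below α,
      ∑ x ∈ ZN d N, mono γ (fun i => (x i : ℝ)) * (pochV (fun i => κ i + 1 + x i) β *
        (pochV (fun i => κ i + 1) x / mfact x)) =
      pochV (fun i => κ i + 1) γ * pochV (fun i => κ i + 1 + γ i) β *
        (poch (s + (∑ i, γ i : ℕ)) (N - ∑ i, γ i) / (Nat.factorial (N - ∑ i, γ i) : ℝ)) := by
    intro γ hγ
    have hs' : ∑ i, (κ i + 1 + β i + γ i) = s + (∑ i, γ i : ℕ) := by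
      rw [Finset.sum_add_distrib]
      push_cast
      rfl
    rw [hpochV, mul_assoc, ← hs', ← sum_ZN_pochV_div_mfact,
      ← sum_ZN_mono_mul_eq _ _ ((sum_le_of_mem_below hγ).trans hN), Finset.mul_sum]
    refine Finset.sum_congr rfl fun x _ => ?_
    rw [← mul_div_assoc, ← mul_div_assoc, mul_comm (pochV _ β), hpochV]
    ring
  have hterm : ∀ γ ∈ below α,
      pochV (fun i => -(α i : ℝ)) γ * poch (s + m) (∑ i, γ i) *
          (-1 : ℝ) ^ (∑ i, γ i) /
          (mfact γ * pochV (fun i => κ i + 1) γ * poch (-(N : ℝ)) (∑ i, γ i)) *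
        ∑ x ∈ ZN d N, mono γ (fun i => (x i : ℝ)) * (pochV (fun i => κ i + 1 + x i) β *
        (pochV (fun i => κ i + 1) x / mfact x)) =
      poch s N / ((Nat.factorial N : ℝ) * poch s m) *
        (pochV (fun i => -(α i : ℝ)) γ / mfact γ *
          (pochV (fun i => κ i + 1 + γ i) β * poch (s + (∑ i, γ i : ℕ)) m)) := by
    intro γ hγ
    have hk := (sum_le_of_mem_below hγ).trans hN
    rw [hinner γ hγ]
    set k := ∑ i, γ i
    have e1 : poch (s + m) k = poch s k * poch (s + k) m / poch s m := by
      rw [eq_div_iff (poch_pos hs0 m).ne', poch_mul_poch_comm, mul_comm]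
    have e2 : poch (s + k) (N - k) = poch s N / poch s k := by
      rw [eq_div_iff (poch_pos hs0 k).ne', mul_comm, ← poch_add, Nat.add_sub_cancel' hk]
    have e3 : (Nat.factorial (N - k) : ℝ) = (-1) ^ k * (Nat.factorial N : ℝ) / poch (-(N : ℝ)) k := by
      rw [eq_div_iff (poch_neg_natCast_ne_zero hk), mul_comm, poch_neg_natCast_mul_factorial hk]
    have h1 := (poch_pos hs0 m).ne'
    have h2 := (poch_pos hs0 k).ne'
    have h3 := poch_neg_natCast_ne_zero hk
    have h4 := (pochV_pos hκ' γ).ne'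
    have h5 := (mfact_pos γ).ne'
    have h6 : (Nat.factorial N : ℝ) ≠ 0 := by positivity
    rw [e1, e2, e3]
    field_simp
  have hswap : ∑ x ∈ ZN d N, monicQ d N κ α (fun i => (x i : ℝ)) *
        pochV (fun i => κ i + 1 + x i) β * (pochV (fun i => κ i + 1) x / mfact x) =
      poch (-(N : ℝ)) n * pochV (fun i => κ i + 1) α / poch (s + m) n *
        ∑ γ ∈ below α, pochV (fun i => -(α i : ℝ)) γ * poch (s + m) (∑ i, γ i) *
          (-1 : ℝ) ^ (∑ i, γ i) /
          (mfact γ * pochV (fun i => κ i + 1) γ * poch (-(N : ℝ)) (∑ i, γ i)) *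
        ∑ x ∈ ZN d N, mono γ (fun i => (x i : ℝ)) * (pochV (fun i => κ i + 1 + x i) β *
          (pochV (fun i => κ i + 1) x / mfact x)) := by
    simp only [monicQ, ← hsm, Finset.mul_sum, Finset.sum_mul]
    rw [Finset.sum_comm]
    refine Finset.sum_congr rfl fun γ _ => Finset.sum_congr rfl fun x _ => ?_
    ring
  rw [hswap, Finset.sum_congr rfl hterm, ← Finset.mul_sum, hvanish, mul_zero, mul_zero]

theorem sum_ZN_monicQ_mul_pochV_mul_mono {d N : ℕ} {κ : Fin (d + 1) → ℝ} (hκ : ∀ i, -1 < κ i)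
    {α : Fin (d + 1) → ℕ} (hN : ∑ i, α i ≤ N) (b : ℕ) (β β' : Fin (d + 1) → ℕ)
    (hb : ∑ i, β i = b) (hβ : ∑ i, β i + ∑ i, β' i < ∑ i, α i) :
    ∑ x ∈ ZN d N, monicQ d N κ α (fun i => (x i : ℝ)) * (mono β (fun i => (x i : ℝ)) *
      pochV (fun i => κ i + 1 + x i) β') * (pochV (fun i => κ i + 1) x / mfact x) = 0 := by
  induction b generalizing β β' with
  | zero =>
    have h0 : β = 0 := by
      ext i
      simpa using (Finset.sum_eq_zero_iff.1 hb) i (mem_univ i)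
    subst h0
    have hmono : ∀ x : Fin (d + 1) → ℝ, mono 0 x = 1 := fun x => by simp [mono, pochV, poch]
    simp only [hmono, one_mul]
    exact sum_ZN_monicQ_mul_pochV hκ hN (by simpa using hβ)
  | succ b ih =>
    obtain ⟨i, hi⟩ : ∃ i, β i ≠ 0 := by
      by_contra! h
      simp [h] at hb
    obtain ⟨δ, rfl⟩ : ∃ δ, β = δ + Pi.single i 1 := by
      refine ⟨β - Pi.single i 1, (tsub_add_cancel_of_le fun j => ?_).symm⟩
      rcases eq_or_ne j i with rfl | hj
      · simpa using Nat.one_le_iff_ne_zero.2 hi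
      · simp [hj]
    rw [sum_add_single] at hb hβ
    have h1 := ih δ (β' + Pi.single i 1) (by omega) (by rw [sum_add_single]; omega)
    have h2 := ih δ β' (by omega) (by omega)
    have h3 := congrArg₂ (fun u v => u - (κ i + 1 + β' i + δ i) * v) h1 h2
    simp only [Finset.mul_sum, ← Finset.sum_sub_distrib, mul_zero, sub_zero] at h3
    rw [← h3]
    refine Finset.sum_congr rfl fun x _ => ?_
    rw [mono_add_single, pochV_add_single]
    ring

/-- the monic Hahn polynomial is orthogonal to lower degrees and is monic. -/
theorem monicHahn_orthogonal_and_monic (d N : ℕ) (hd : 1 ≤ d) (κ : Fin (d + 1) → ℝ)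
    (hκ : ∀ i, -1 < κ i) (α : Fin (d + 1) → ℕ) (h1 : 1 ≤ ∑ i, α i) (hN : ∑ i, α i ≤ N) :
    (∀ β : Fin (d + 1) → ℕ, ∑ i, β i < ∑ i, α i →
        ∑ x ∈ ZN d N,
          monicQ d N κ α (fun i => (x i : ℝ)) * mono β (fun i => (x i : ℝ)) *
            pochV (fun i => κ i + 1) x / mfact x = 0) ∧
      poch (-(N : ℝ)) (∑ i, α i) * pochV (fun i => κ i + 1) α /
            poch ((∑ i, κ i) + d + (∑ i, α i)) (∑ i, α i) *
          (pochV (fun i => -(α i : ℝ)) α * poch ((∑ i, κ i) + d + (∑ i, α i)) (∑ i, α i) *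
              (-1 : ℝ) ^ (∑ i, α i) /
            (mfact α * pochV (fun i => κ i + 1) α * poch (-(N : ℝ)) (∑ i, α i))) = 1 := by
  refine ⟨fun β hβ => ?_, ?_⟩
  · have h := sum_ZN_monicQ_mul_pochV_mul_mono hκ hN _ β 0 rfl (by simpa using hβ)
    simpa [pochV, poch, mul_div_assoc] using h
  · have hκ' : ∀ i, 0 < κ i + 1 := fun i => by linarith [hκ i]
    have hA : 0 < (∑ i, κ i) + d + (∑ i, α i : ℕ) := by
      have hpos := Finset.sum_pos (fun i _ => hκ' i) univ_nonempty
      have hα : (1 : ℝ) ≤ (∑ i, α i : ℕ) := by exact_mod_cast h1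
      simp [Finset.sum_add_distrib] at hpos
      linarith
    have hfact : pochV (fun i => -(α i : ℝ)) α * (-1) ^ (∑ i, α i) = mfact α := by
      rw [pochV, mfact, ← Finset.prod_pow_eq_pow_sum, ← prod_mul_distrib]
      refine Finset.prod_congr rfl fun i _ => ?_
      have h := poch_neg_natCast_mul_factorial (le_refl (α i))
      rw [Nat.sub_self, Nat.factorial_zero, Nat.cast_one, mul_one] at h
      rw [h, mul_right_comm, ← mul_pow]
      simp
    have e1 := (poch_pos hA (∑ i, α i)).ne'
    have e2 := (pochV_pos hκ' α).ne'
    have e3 := poch_neg_natCast_ne_zero hN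
    have e4 := (mfact_pos α).ne'
    rw [mul_right_comm, hfact]
    field_simp
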